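/- Let p', q', r' be words over {0,1} and let a, b ∈ {0,1}. Set p = h(p')·0·a, q = 1·h(q')·0, and r = b·1·h(r'). Then it is not the case that both p ~_2 q and p ~_2 r. -/

import Mathlib

/-- Number of occurrences of `v` as a scattered subword (subsequence) of `u`. -/
def binomC {α : Type*} [DecidableEq α] (u v : List α) : ℕ := u.sublists.count v

/-- Two words are 2-binomially equivalent. -/
def binEq2 {α : Type*} [DecidableEq α] (u v : List α) : Prop :=
  ∀ x : List α, x.length ≤ 2 → binomC u x = binomC v x

/-- The morphism h : 0 ↦ 001, 1 ↦ 011. -/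
def h : Fin 2 → List (Fin 2) := ![[0,0,1],[0,1,1]]

/-- Apply the morphism h to a word. -/
def hWord (w : List (Fin 2)) : List (Fin 2) := w.flatMap h

theorem binomC_cons_cons {α : Type*} [DecidableEq α] (c d : α) (u v : List α) :
    binomC (c :: u) (d :: v) = binomC u (d :: v) + if c = d then binomC u v else 0 := by
  unfold binomC
  rw [(List.sublists_perm_sublists' (c :: u)).count_eq, (List.sublists_perm_sublists' u).count_eq,
    (List.sublists_perm_sublists' u).count_eq, List.sublists'_cons, List.count_append]
  congr 1
  split_ifs with hcd
  · subst hcd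
    exact List.count_map_of_injective _ _ List.cons_injective _
  · rw [List.count_eq_zero]
    simp [hcd]

theorem binomC_nil_cons {α : Type*} [DecidableEq α] (d : α) (v : List α) :
    binomC [] (d :: v) = 0 := by
  simp [binomC]

theorem binomC_nil_right {α : Type*} [DecidableEq α] (u : List α) : binomC u [] = 1 := by
  induction u with
  | nil => simp [binomC]
  | cons c u ih =>
    unfold binomC at *
    rw [(List.sublists_perm_sublists' _).count_eq] at *
    rw [List.sublists'_cons, List.count_append, ih, Nat.add_eq_left, List.count_eq_zero]
    simp

/-- Here `n` is the length of `w` and `m` its number of ones; the number of occurrences of `01`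
in `hWord w` is determined modulo 3 by `n` and `m`. -/
theorem exists_binomC_hWord_append (w : List (Fin 2)) :
    ∃ n m s : ℤ, ∀ t : List (Fin 2),
      (binomC (hWord w ++ t) [0] : ℤ) = 2 * n - m + binomC t [0] ∧
      (binomC (hWord w ++ t) [1] : ℤ) = n + m + binomC t [1] ∧
      (binomC (hWord w ++ t) [0, 1] : ℤ) =
        binomC t [0, 1] + (2 * n - m) * binomC t [1] + (n ^ 2 + n - n * m + m ^ 2 + 3 * s) := by
  induction w with
  | nil => exact ⟨0, 0, 0, fun t => by simp [hWord]⟩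
  | cons c w ih =>
    obtain ⟨n, m, s, ih⟩ := ih
    have hcons : ∀ t, hWord (c :: w) ++ t = h c ++ (hWord w ++ t) := by simp [hWord]
    obtain rfl | rfl : c = 0 ∨ c = 1 := by omega
    · refine ⟨n + 1, m, s + m, fun t => ?_⟩
      obtain ⟨h0, h1, h01⟩ := ih t
      simp only [hcons]
      simp [h, binomC_cons_cons, binomC_nil_right, h0, h1, h01]
      refine ⟨?_, ?_, ?_⟩ <;> ring
    · refine ⟨n + 1, m + 1, s, fun t => ?_⟩
      obtain ⟨h0, h1, h01⟩ := ih t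
      simp only [hcons]
      simp [h, binomC_cons_cons, binomC_nil_right, h0, h1, h01]
      refine ⟨?_, ?_, ?_⟩ <;> ring

/-- Words of the form h(p')0a, 1h(q')0, b1h(r') cannot be pairwise 2-binomially equivalent. -/
theorem cube_desubstitution_case_two
    (p' q' r' : List (Fin 2)) (a b : Fin 2) :
    ¬ (binEq2 (hWord p' ++ [0, a]) ((1 : Fin 2) :: (hWord q' ++ [0])) ∧
       binEq2 (hWord p' ++ [0, a]) (b :: 1 :: hWord r')) := by
  rintro ⟨hq, hr⟩
  obtain ⟨n, m, s, hp'⟩ := exists_binomC_hWord_append p'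
  obtain ⟨n₁, m₁, s₁, hq'⟩ := exists_binomC_hWord_append q'
  obtain ⟨n₂, m₂, s₂, hr'⟩ := exists_binomC_hWord_append r'
  obtain ⟨p0, p1, p01⟩ := hp' [0, a]
  obtain ⟨q0, q1, q01⟩ := hq' [0]
  obtain ⟨r0, r1, r01⟩ := hr' []
  have eq0 := congrArg (Nat.cast (R := ℤ)) (hq [0] (by simp))
  have eq1 := congrArg (Nat.cast (R := ℤ)) (hq [1] (by simp))
  have eq01 := congrArg (Nat.cast (R := ℤ)) (hq [0, 1] (by simp))
  have er0 := congrArg (Nat.cast (R := ℤ)) (hr [0] (by simp))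
  have er1 := congrArg (Nat.cast (R := ℤ)) (hr [1] (by simp))
  have er01 := congrArg (Nat.cast (R := ℤ)) (hr [0, 1] (by simp))
  rw [List.append_nil] at r0 r1 r01
  obtain rfl | rfl : a = 0 ∨ a = 1 := by omega
  all_goals
    obtain rfl | rfl : b = 0 ∨ b = 1 := by omega
    all_goals
      simp [binomC_cons_cons, binomC_nil_right, binomC_nil_cons] at p0 p1 p01 q0 q1 q01 r0 r1 r01
      simp [binomC_cons_cons, binomC_nil_right, p0, p1, p01, q0, q1, q01, r0, r1, r01]
        at eq0 eq1 eq01 er0 er1 er01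
      obtain rfl : n₁ = n := by omega
      obtain rfl : n₂ = n₁ := by omega
      obtain hm | hm : m = m₁ + 1 ∨ m = m₁ := by omega
      all_goals
        obtain hm₂ | hm₂ : m₂ = m₁ ∨ m₂ = m₁ - 1 := by omega
        all_goals
          rw [hm] at eq01 er01
          rw [hm₂] at er01
          ring_nf at eq01 er01
          omega
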